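/- Let n ≥ 3 and write 2* = (n+2)/(n−2). Let (p_k) be a sequence with p_k ∈ [n/(n−2), 2*] for all k and p_k → 2* as k → ∞, and let (U_{p_k}, V_{p_k}) be the corresponding ground states. Then ‖∇(U_{p_k} − U_{2*})‖_{L²(ℝⁿ)} → 0 and ‖∇(V_{p_k} − V_{2*})‖_{L²(ℝⁿ)} → 0 as k → ∞, where U_{2*} = V_{2*} and U_{2*}(x) = c_n^* (b_n/(b_n² + |x|²))^{(n−2)/2} with c_n^* = [n(n−2)]^{(n−2)/4} and b_n = (c_n^*)^{2/(n−2)}. -/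

import Mathlib

open Filter MeasureTheory Topology

noncomputable def lap {n : ℕ} (f : EuclideanSpace ℝ (Fin n) → ℝ)
    (x : EuclideanSpace ℝ (Fin n)) : ℝ :=
  ∑ i, fderiv ℝ (fderiv ℝ f) x (EuclideanSpace.single i 1) (EuclideanSpace.single i 1)

def IsGroundState (n : ℕ) (p q : ℝ) (U V : EuclideanSpace ℝ (Fin n) → ℝ) : Prop :=
  ContDiff ℝ 2 U ∧ ContDiff ℝ 2 V ∧
  (∀ x, 0 < U x) ∧ (∀ x, 0 < V x) ∧
  (∀ x, -lap U x = V x ^ p) ∧ (∀ x, -lap V x = U x ^ q) ∧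
  (∀ x y, ‖x‖ ≤ ‖y‖ → U y ≤ U x) ∧
  (∀ x y, ‖x‖ ≤ ‖y‖ → V y ≤ V x) ∧
  Tendsto U (cocompact _) (nhds 0) ∧
  Tendsto V (cocompact _) (nhds 0) ∧
  U 0 = 1


structure Prof (l : ℕ) (u u1 h : ℝ → ℝ) : Prop where
  d0 : ∀ r, HasDerivAt u (u1 r) r
  d1 : ∀ r, 0 < r → HasDerivAt u1 (-((l + 2 : ℝ) / r * u1 r) - h r) r
  c1 : Continuous u1
  pos : ∀ r, 0 < u r
  hpos : ∀ r, 0 ≤ h r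
  neg : ∀ r, 0 ≤ r → u1 r ≤ 0

lemma antitone_aux {f f' : ℝ → ℝ} {a : ℝ} (hc : ContinuousOn f (Set.Ici a))
    (hd : ∀ r, a < r → HasDerivAt f (f' r) r) (hn : ∀ r, a < r → f' r ≤ 0) :
    AntitoneOn f (Set.Ici a) := by
  apply antitoneOn_of_deriv_nonpos (convex_Ici a) hc
  · intro x hx
    rw [interior_Ici] at hx
    exact (hd x hx).differentiableAt.differentiableWithinAt
  · intro x hx
    rw [interior_Ici] at hx
    rw [(hd x hx).deriv]; exact hn x hx

lemma antitone_aux_Icc {f f' : ℝ → ℝ} {a b : ℝ} (hc : ContinuousOn f (Set.Icc a b))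
    (hd : ∀ r, a < r → r < b → HasDerivAt f (f' r) r) (hn : ∀ r, a < r → r < b → f' r ≤ 0) :
    AntitoneOn f (Set.Icc a b) := by
  apply antitoneOn_of_deriv_nonpos (convex_Icc a b) hc
  · intro x hx
    rw [interior_Icc] at hx
    exact (hd x hx.1 hx.2).differentiableAt.differentiableWithinAt
  · intro x hx
    rw [interior_Icc] at hx
    rw [(hd x hx.1 hx.2).deriv]; exact hn x hx.1 hx.2

lemma Prof.c0 {l : ℕ} {u u1 h : ℝ → ℝ} (P : Prof l u u1 h) : Continuous u :=
  continuous_iff_continuousAt.2 fun r => (P.d0 r).continuousAt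

lemma rpow_lip {s x y : ℝ} (hs : 1 ≤ s) (hx : 0 ≤ x) (hx1 : x ≤ 1) (hy : 0 ≤ y) (hy1 : y ≤ 1) :
    |y ^ s - x ^ s| ≤ s * |y - x| := by
  have := Convex.norm_image_sub_le_of_norm_hasDerivWithin_le (f := fun t : ℝ => t ^ s)
    (f' := fun t => s * t ^ (s - 1)) (s := Set.Icc (0:ℝ) 1) (x := x) (y := y) (C := s)
    (fun t ht => (Real.hasDerivAt_rpow_const (Or.inr hs)).hasDerivWithinAt)
    (fun t ht => by
      rw [Real.norm_of_nonneg (mul_nonneg (by linarith) (Real.rpow_nonneg ht.1 _))]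
      have := Real.rpow_le_one ht.1 ht.2 (by linarith : 0 ≤ s - 1)
      nlinarith) (convex_Icc 0 1) ⟨hx, hx1⟩ ⟨hy, hy1⟩
  simpa [Real.norm_eq_abs] using this

lemma rpow_exp_diff {p s x : ℝ} (hp : 1 ≤ p) (hps : p ≤ s) (hx : 0 < x) (hx1 : x ≤ 1) :
    0 ≤ x ^ p - x ^ s ∧ x ^ p - x ^ s ≤ s - p := by
  have h1 : x ^ s = x ^ p * x ^ (s - p) := by
    rw [← Real.rpow_add hx]; congr 1; ring
  have h2 : 1 + (s - p) * Real.log x ≤ x ^ (s - p) := by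
    rw [Real.rpow_def_of_pos hx]
    have := Real.add_one_le_exp (Real.log x * (s - p))
    linarith
  have h3 : x ^ p ≤ x := by
    simpa using Real.rpow_le_rpow_of_exponent_ge hx hx1 hp
  have h4 : x ^ (s - p) ≤ 1 := Real.rpow_le_one hx.le hx1 (by linarith)
  have h5 : 0 < x ^ p := Real.rpow_pos_of_pos hx _
  have h6 : 1 - x⁻¹ ≤ Real.log x := Real.one_sub_inv_le_log_of_pos hx
  have h7 : x * (- Real.log x) ≤ 1 := by
    have : x * (1 - x⁻¹) ≤ x * Real.log x := mul_le_mul_of_nonneg_left h6 hx.le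
    rw [mul_sub, mul_inv_cancel₀ hx.ne'] at this
    linarith
  have h8 : Real.log x ≤ 0 := Real.log_nonpos hx.le hx1
  constructor
  · rw [h1]; nlinarith
  · have : x ^ p * (1 - x ^ (s - p)) ≤ x ^ p * (-(s - p) * Real.log x) :=
      mul_le_mul_of_nonneg_left (by linarith) h5.le
    have h9 : x ^ p * (- Real.log x) ≤ 1 := by nlinarith
    have h10 : (s - p) * (x ^ p * (- Real.log x)) ≤ (s - p) * 1 :=
      mul_le_mul_of_nonneg_left h9 (by linarith)
    rw [h1]; nlinarith

lemma prof_gronwall {l : ℕ} {s ε : ℝ} {w w1 h f f1 : ℝ → ℝ} (hs : 1 ≤ s)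
    (W : Prof l w w1 h) (F : Prof l f f1 (fun r => f r ^ s)) (hw1 : ∀ r, w r ≤ 1)
    (hf1 : ∀ r, f r ≤ 1) (hε : ∀ r, |h r - w r ^ s| ≤ ε) (r : ℝ) (hr : 0 ≤ r) :
    (w r - f r) ^ 2 + (w1 r - f1 r) ^ 2 ≤
      ((w 0 - f 0) ^ 2 + (w1 0 - f1 0) ^ 2 + ε ^ 2) * Real.exp ((s + 2) * r) := by
  have key := antitone_aux (a := 0)
    (f := fun r => ((w r - f r) ^ 2 + (w1 r - f1 r) ^ 2 + ε ^ 2) * Real.exp (-(s + 2) * r))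
    (f' := fun r => (2 * (w r - f r) * (w1 r - f1 r) + 2 * (w1 r - f1 r) *
       ((-((l + 2 : ℝ) / r * w1 r) - h r) - (-((l + 2 : ℝ) / r * f1 r) - f r ^ s))) *
        Real.exp (-(s + 2) * r) + ((w r - f r) ^ 2 + (w1 r - f1 r) ^ 2 + ε ^ 2) *
          (Real.exp (-(s + 2) * r) * (-(s + 2))))
    (by
      have := W.c0; have := F.c0; have := W.c1; have := F.c1
      apply Continuous.continuousOn; fun_prop)
    (by
      intro r hr
      have h1 := ((W.d0 r).sub (F.d0 r)).pow 2
      have h2 := ((W.d1 r hr).sub (F.d1 r hr)).pow 2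
      have h3 : HasDerivAt (fun r => Real.exp (-(s + 2) * r))
          (Real.exp (-(s + 2) * r) * (-(s + 2))) r := by
        simpa using ((hasDerivAt_id r).const_mul (-(s + 2))).exp
      refine (((h1.add h2).add_const (ε ^ 2)).mul h3).congr_deriv ?_
      simp)
    (by
      intro r hr
      have hh : |h r - f r ^ s| ≤ ε + s * |w r - f r| := by
        have e1 := hε r
        have e2 := rpow_lip hs (F.pos r).le (hf1 r) (W.pos r).le (hw1 r)
        calc |h r - f r ^ s| = |(h r - w r ^ s) + (w r ^ s - f r ^ s)| := by ring_nf
          _ ≤ _ := abs_add_le _ _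
          _ ≤ _ := add_le_add e1 e2
      set z := w r - f r
      set y := w1 r - f1 r with hy
      set g := h r - f r ^ s with hg
      have e0 : (-((l + 2 : ℝ) / r * w1 r) - h r) - (-((l + 2 : ℝ) / r * f1 r) - f r ^ s)
        = -((l + 2 : ℝ) / r * y) - g := by rw [hy, hg]; ring
      rw [e0]
      have e1 : 0 ≤ (l + 2 : ℝ) / r * y ^ 2 := by positivity
      have e2 : -(y * g) ≤ |y| * (ε + s * |z|) := by
        calc -(y * g) ≤ |y * g| := neg_le_abs _
          _ = |y| * |g| := abs_mul _ _
          _ ≤ _ := mul_le_mul_of_nonneg_left hh (abs_nonneg _)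
      have e3 : 2 * (|y| * |z|) ≤ z ^ 2 + y ^ 2 := by
        nlinarith [sq_nonneg (|y| - |z|), sq_abs y, sq_abs z]
      have e4 : 2 * |y| * ε ≤ y ^ 2 + ε ^ 2 := by
        nlinarith [sq_nonneg (|y| - ε), sq_abs y]
      have e5 : 2 * z * y ≤ z ^ 2 + y ^ 2 := by nlinarith [sq_nonneg (z - y)]
      have e6 : s * (2 * (|y| * |z|)) ≤ s * (z ^ 2 + y ^ 2) :=
        mul_le_mul_of_nonneg_left e3 (by linarith)
      have e7 : (2 * z * y + 2 * y * (-((l + 2 : ℝ) / r * y) - g))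
          - (s + 2) * (z ^ 2 + y ^ 2 + ε ^ 2) ≤ 0 := by nlinarith [sq_nonneg ε, sq_nonneg z]
      have e8 := Real.exp_pos (-(s + 2) * r)
      nlinarith)
  have := key (Set.self_mem_Ici) (Set.mem_Ici.2 hr) hr
  simp only [mul_zero, Real.exp_zero, mul_one] at this
  have e8 := Real.exp_pos ((s + 2) * r)
  have e9 : Real.exp (-(s + 2) * r) * Real.exp ((s + 2) * r) = 1 := by
    rw [← Real.exp_add, ← Real.exp_zero]; congr 1; ring
  have := mul_le_mul_of_nonneg_right this e8.le
  rw [mul_assoc, e9] at this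
  nlinarith [sq_nonneg ε]

lemma prof_k_nonneg {l : ℕ} {u u1 h : ℝ → ℝ} (P : Prof l u u1 h) (r : ℝ) (hr : 0 ≤ r) :
    0 ≤ r * u1 r + (l + 1 : ℝ) * u r := by
  by_contra! hneg
  have hc1 := P.c1
  have hc0 := P.c0
  have hr0 : 0 < r := by
    rcases hr.eq_or_lt with h0 | h0
    · subst h0
      have := P.pos 0
      simp at hneg
      nlinarith [(Nat.cast_nonneg l : (0:ℝ) ≤ l)]
    · exact h0
  have kanti := antitone_aux (a := 0) (f := fun r => r * u1 r + (l + 1 : ℝ) * u r)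
    (f' := fun r => 1 * u1 r + r * (-((l + 2 : ℝ) / r * u1 r) - h r) + (l + 1 : ℝ) * u1 r)
    (by apply Continuous.continuousOn; fun_prop)
    (fun r hr => ((hasDerivAt_id r).mul (P.d1 r hr)).add ((P.d0 r).const_mul _))
    (fun r hr => by
      have : 1 * u1 r + r * (-((l + 2 : ℝ) / r * u1 r) - h r) + (l + 1 : ℝ) * u1 r
        = - (r * h r) := by field_simp; ring
      rw [this]
      have := P.hpos r
      nlinarith [mul_nonneg hr.le this])
  set c := -(r * u1 r + (l + 1 : ℝ) * u r) with hcdef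
  have hc : 0 < c := by linarith
  have a2 := antitone_aux (a := r) (f := fun t => u t + c * Real.log t)
    (f' := fun t => u1 t + c * t⁻¹)
    (by
      apply ContinuousOn.add hc0.continuousOn
      apply ContinuousOn.mul continuousOn_const
      apply Real.continuousOn_log.mono
      intro t ht
      have : r ≤ t := ht
      simp; linarith)
    (fun t ht => (P.d0 t).add ((Real.hasDerivAt_log (by linarith)).const_mul c))
    (fun t ht => by
      have ht0 : 0 < t := hr0.trans ht
      have := kanti (Set.mem_Ici.2 hr) (Set.mem_Ici.2 ht0.le) ht.le
      simp only at this
      have h2 : 0 ≤ (l + 1 : ℝ) * u t := mul_nonneg (by positivity) (P.pos t).le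
      have h3 : t * u1 t + c ≤ 0 := by linarith
      have : u1 t + c * t⁻¹ = (t * u1 t + c) * t⁻¹ := by field_simp
      rw [this]
      exact mul_nonpos_of_nonpos_of_nonneg h3 (by positivity))
  have hT : ∀ t, r ≤ t → Real.log t ≤ (u r + c * Real.log r) / c := by
    intro t ht
    have := a2 (Set.self_mem_Ici) (Set.mem_Ici.2 ht) ht
    simp only at this
    rw [le_div_iff₀ hc]
    have := P.pos t
    linarith
  obtain ⟨t, ht1, ht2⟩ := ((Real.tendsto_log_atTop.eventually_gt_atTop
    ((u r + c * Real.log r) / c)).and (eventually_ge_atTop r)).exists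
  exact absurd (hT t ht2) (not_le.2 ht1)

lemma prof_f_mono {l : ℕ} {u u1 h : ℝ → ℝ} (P : Prof l u u1 h) {R r : ℝ} (hR : 0 ≤ R)
    (hr : R ≤ r) : R ^ (l + 1) * u R ≤ r ^ (l + 1) * u r := by
  have hc0 := P.c0
  have := antitone_aux (a := 0) (f := fun r => - (r ^ (l + 1) * u r))
    (f' := fun r => -(((l + 1 : ℕ) * r ^ l) * u r + r ^ (l + 1) * u1 r))
    (by apply Continuous.continuousOn; fun_prop)
    (fun r hr => by
      refine ((hasDerivAt_pow (l + 1) r).mul (P.d0 r)).neg.congr_deriv ?_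
      simp)
    (fun r hr => by
      have := mul_nonneg (pow_nonneg hr.le l) (prof_k_nonneg P r hr.le)
      push_cast
      have e : (l + 1 : ℝ) * r ^ l * u r + r ^ (l + 1) * u1 r
        = r ^ l * (r * u1 r + (l + 1 : ℝ) * u r) := by ring
      rw [e]; linarith)
  have := this (Set.mem_Ici.2 hR) (Set.mem_Ici.2 (hR.trans hr)) hr
  simp only at this
  linarith

lemma prof_pohozaev {l : ℕ} {p q a b : ℝ} {u u1 v v1 : ℝ → ℝ}
    (PU : Prof l u u1 (fun r => v r ^ p)) (PV : Prof l v v1 (fun r => u r ^ q))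
    (hp : 0 < p) (hq : 0 < q) (ha : a * (q + 1) = l + 3) (hb : b * (p + 1) = l + 3)
    (hab : a + b = l + 1) (r : ℝ) (hr : 0 < r) :
    (r * u1 r + a * u r) * (r * v1 r + b * v r) = a * b * (u r * v r) -
      r ^ 2 * (v r ^ (p + 1) / (p + 1) + u r ^ (q + 1) / (q + 1)) := by
  have hcu := PU.c0
  have hcv := PV.c0
  have hcu1 := PU.c1
  have hcv1 := PV.c1
  let G : ℝ → ℝ := fun r => r ^ (l + 3) * (u1 r * v1 r +
    (v r ^ (p + 1) / (p + 1) + u r ^ (q + 1) / (q + 1))) +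
    r ^ (l + 2) * (a * (u r * v1 r) + b * (v r * u1 r))
  have hGc : Continuous G := by
    have h1 : Continuous (fun r => v r ^ (p + 1)) :=
      hcv.rpow_const (fun x => Or.inl (PV.pos x).ne')
    have h2 : Continuous (fun r => u r ^ (q + 1)) :=
      hcu.rpow_const (fun x => Or.inl (PU.pos x).ne')
    fun_prop
  have hGd : ∀ r, 0 < r → HasDerivAt G 0 r := by
    intro r hr
    have h1 : HasDerivAt (fun r => v r ^ (p + 1) / (p + 1)) (v1 r * v r ^ p) r := by
      have := ((PV.d0 r).rpow_const (p := p + 1) (Or.inl (PV.pos r).ne')).div_const (p + 1)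
      refine this.congr_deriv ?_
      rw [add_sub_cancel_right]
      field_simp
    have h2 : HasDerivAt (fun r => u r ^ (q + 1) / (q + 1)) (u1 r * u r ^ q) r := by
      have := ((PU.d0 r).rpow_const (p := q + 1) (Or.inl (PU.pos r).ne')).div_const (q + 1)
      refine this.congr_deriv ?_
      rw [add_sub_cancel_right]
      field_simp
    have dU := PU.d0 r
    have dV := PV.d0 r
    have dU1 := PU.d1 r hr
    have dV1 := PV.d1 r hr
    have := ((hasDerivAt_pow (l + 3) r).mul ((dU1.mul dV1).add (h1.add h2))).add
      ((hasDerivAt_pow (l + 2) r).mul (((dU.mul dV1).const_mul a).add ((dV.mul dU1).const_mul b)))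
    refine this.congr_deriv ?_
    symm
    simp only [Pi.mul_apply, Pi.add_apply]
    have e1 : v r ^ (p + 1) = v r ^ p * v r := Real.rpow_add_one (PV.pos r).ne' p
    have e2 : u r ^ (q + 1) = u r ^ q * u r := Real.rpow_add_one (PU.pos r).ne' q
    rw [e1, e2]
    generalize v r ^ p = A
    generalize u r ^ q = B
    have ha' : (l + 3 : ℝ) / (q + 1) = a := by rw [← ha]; field_simp
    have hb' : (l + 3 : ℝ) / (p + 1) = b := by rw [← hb]; field_simp
    have hA : A * v r / (p + 1) * (l + 3) = A * v r * b := by rw [← hb']; ring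
    have hB : B * u r / (q + 1) * (l + 3) = B * u r * a := by rw [← ha']; ring
    have e3 : l + 3 - 1 = l + 2 := by omega
    have e4 : l + 2 - 1 = l + 1 := by omega
    rw [e3, e4]
    push_cast
    have e5 : (l : ℝ) = a + b - 1 := by linarith
    have hr' : r ≠ 0 := hr.ne'
    have : (l + 2 : ℝ) / r * r = l + 2 := by field_simp
    set D := (l + 2 : ℝ) / r
    have hD : (l + 2 : ℝ) = D * r := this.symm
    have ep : r ^ (l + 2) = r ^ (l + 1) * r := by ring
    have ep3 : r ^ (l + 3) = r ^ (l + 1) * r * r := by ring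
    rw [ep, ep3]
    have : 0 = r ^ (l + 1) * r * (u1 r * v1 r * (a + b - 1 - l) + (A * v r / (p + 1) * (l + 3) - A * v r * b)
      + (B * u r / (q + 1) * (l + 3) - B * u r * a)) := by
      rw [hA, hB, e5]; ring
    rw [this]
    linear_combination (-(r ^ (l + 1) * r * (2 * u1 r * v1 r)) - r ^ (l+1) * (a * (u r * v1 r) + b * (v r * u1 r))) * hD
  have hG : G r = G 0 := by
    have h1 := antitone_aux (a := 0) hGc.continuousOn hGd (fun _ _ => le_rfl)
    have h2 := antitone_aux (a := 0) (f := fun r => -G r) (f' := fun r => -0) hGc.neg.continuousOn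
      (fun r hr => (hGd r hr).neg) (fun _ _ => by simp)
    have := h1 (Set.self_mem_Ici) (Set.mem_Ici.2 hr.le) hr.le
    have := h2 (Set.self_mem_Ici) (Set.mem_Ici.2 hr.le) hr.le
    simp only at this
    linarith
  have hG0 : G 0 = 0 := by simp [G]
  rw [hG0] at hG
  simp only [G] at hG
  have : r ^ (l + 1) * (r * ( r * (u1 r * v1 r + (v r ^ (p + 1) / (p + 1) + u r ^ (q + 1) / (q + 1)))
     + (a * (u r * v1 r) + b * (v r * u1 r)))) = 0 := by rw [← hG]; ring
  have := (mul_eq_zero.1 this).resolve_left (by positivity)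
  linear_combination this

lemma cont_induction {f : ℝ → ℝ} {R : ℝ} (hf : Continuous f) (h0 : 0 < f R)
    (hstep : ∀ r, R ≤ r → (∀ s, R ≤ s → s ≤ r → 0 ≤ f s) → 0 < f r) : ∀ r, R ≤ r → 0 < f r := by
  intro r hr
  have key : Set.Icc R r ⊆ {x | 0 ≤ f x ∧ True} ∩ {x | ∀ s, R ≤ s → s ≤ x → 0 ≤ f s} := by
    by_contra hcon
    have hB : ∃ t ∈ Set.Icc R r, f t < 0 := by
      by_contra! hB
      apply hcon
      intro x hx
      exact ⟨⟨hB x hx, trivial⟩, fun s hs1 hs2 => hB s ⟨hs1, hs2.trans hx.2⟩⟩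
    obtain ⟨t, ht, htf⟩ := hB
    let S := {x | x ∈ Set.Icc R t ∧ f x ≤ 0}
    have hSc : IsClosed S := isClosed_Icc.inter (isClosed_le hf continuous_const)
    have hSne : S.Nonempty := ⟨t, ⟨ht.1, le_rfl⟩, htf.le⟩
    have hSb : BddBelow S := ⟨R, fun x hx => hx.1.1⟩
    have hmem := hSc.csInf_mem hSne hSb
    have : 0 < f (sInf S) := by
      apply hstep _ hmem.1.1
      intro s hs1 hs2
      rcases hs2.eq_or_lt with h | h
      ·
        by_contra! hneg
        have hRs : R < s := by
          rcases hs1.eq_or_lt with h' | h'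
          · rw [← h'] at hneg; linarith
          · exact h'
        have h1 : ∀ᶠ y in 𝓝 s, f y < 0 := hf.continuousAt.eventually_lt continuousAt_const hneg
        have h2 : ∀ᶠ y in 𝓝[<] s, f y < 0 := h1.filter_mono nhdsWithin_le_nhds
        have h3 : ∀ᶠ y in 𝓝[<] s, y ∈ Set.Ioo R s := Ioo_mem_nhdsLT hRs
        obtain ⟨y, hy1, hy2⟩ := (h2.and h3).exists
        have : y ∈ S := ⟨⟨hy2.1.le, by have := hmem.1.2; linarith [hy2.2]⟩, hy1.le⟩
        have := csInf_le hSb this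
        linarith [hy2.2]
      · by_contra! hneg
        have : s ∈ S := ⟨⟨hs1, by have := hmem.1.2; linarith⟩, hneg.le⟩
        have := csInf_le hSb this
        linarith
    linarith [hmem.2]
  exact hstep r hr (key ⟨hr, le_rfl⟩).2

lemma boot_alg {l : ℕ} {p q s M r u v : ℝ} (hs : s * (l + 1) = 2 * l + 5) (hp : s ≤ p + 1)
    (hq : s ≤ q + 1) (hr : 0 < r) (hu : 0 < u) (hu1 : u ≤ 1) (hv : 0 < v) (hv1 : v ≤ 1)
    (hf : r ^ (l + 1) * u ≤ 2 * M) (hg : r ^ (l + 1) * v ≤ 2 * M) :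
    r ^ (2 * l + 5) * (v ^ (p + 1) / (p + 1) + u ^ (q + 1) / (q + 1)) ≤ 2 * (2 * M) ^ s := by
  have hs1 : 1 ≤ s := by
    by_contra! h
    have hl : (0:ℝ) ≤ l := Nat.cast_nonneg l
    nlinarith
  have hR : (r ^ (l + 1)) ^ s = r ^ (2 * l + 5) := by
    rw [← Real.rpow_natCast r (l + 1), ← Real.rpow_mul hr.le, ← Real.rpow_natCast r (2 * l + 5)]
    congr 1
    push_cast
    linarith
  have aux : ∀ w t : ℝ, 0 < w → w ≤ 1 → s ≤ t + 1 → r ^ (l + 1) * w ≤ 2 * M →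
      r ^ (2 * l + 5) * (w ^ (t + 1) / (t + 1)) ≤ (2 * M) ^ s := by
    intro w t hw hw1 ht hM
    have h1 : w ^ (t + 1) / (t + 1) ≤ w ^ s := by
      have : w ^ (t + 1) ≤ w ^ s := Real.rpow_le_rpow_of_exponent_ge hw hw1 ht
      refine le_trans (div_le_self (Real.rpow_nonneg hw.le _) (by linarith)) this
    calc r ^ (2 * l + 5) * (w ^ (t + 1) / (t + 1)) ≤ r ^ (2 * l + 5) * w ^ s :=
          mul_le_mul_of_nonneg_left h1 (by positivity)
      _ = (r ^ (l + 1) * w) ^ s := by rw [Real.mul_rpow (by positivity) hw.le, hR]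
      _ ≤ (2 * M) ^ s := Real.rpow_le_rpow (by positivity) hM (by linarith)
  have h1 := aux v p hv hv1 hp hg
  have h2 := aux u q hu hu1 hq hf
  linarith

set_option maxHeartbeats 1000000 in
lemma prof_boot {l : ℕ} {p q a b s a0 m M R : ℝ} {u u1 v v1 : ℝ → ℝ}
    (PU : Prof l u u1 (fun r => v r ^ p)) (PV : Prof l v v1 (fun r => u r ^ q))
    (hu1 : ∀ r, u r ≤ 1) (hv1 : ∀ r, v r ≤ 1)
    (hp : 0 < p) (hq : 0 < q) (ha : a * (q + 1) = l + 3) (hb : b * (p + 1) = l + 3)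
    (hab : a + b = l + 1) (hs : s * (l + 1) = 2 * l + 5) (hps : s ≤ p + 1)
    (hqs : s ≤ q + 1) (ha0 : 0 < a0) (haa : a0 ≤ a) (hbb : a0 ≤ b) (hm : 0 < m)
    (hR : 0 < R) (hmu : m ≤ R ^ (l + 1) * u R) (hmv : m ≤ R ^ (l + 1) * v R)
    (hMu : R ^ (l + 1) * u R ≤ M) (hMv : R ^ (l + 1) * v R ≤ M)
    (hku : R * u1 R + (l + 1 : ℝ) * u R < b * u R)
    (hkv : R * v1 R + (l + 1 : ℝ) * v R < a * v R)
    (hR1 : 2 * (2 * M) ^ s < a0 * m * M * R) (hR2 : 2 * (2 * M) ^ s < a0 ^ 2 * m ^ 2 * R) :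
    ∀ r, R ≤ r → r ^ (l + 1) * u r ≤ 2 * M ∧ r ^ (l + 1) * v r ≤ 2 * M := by
  have hcu := PU.c0
  have hcv := PV.c0
  have hcu1 := PU.c1
  have hcv1 := PV.c1
  have hM : 0 < M := by linarith
  have hap : 0 < a := ha0.trans_le haa
  have hbp : 0 < b := ha0.trans_le hbb
  set C := 2 * (2 * M) ^ s with hC
  have hC0 : 0 < C := by positivity
  let F : ℝ → ℝ := fun r => min (min (b * u r - (r * u1 r + (l + 1 : ℝ) * u r))
    (a * v r - (r * v1 r + (l + 1 : ℝ) * v r)))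
    (min (2 * M - r ^ (l + 1) * u r) (2 * M - r ^ (l + 1) * v r))
  have hFc : Continuous F := by fun_prop
  have hF0 : 0 < F R := by
    simp only [F, lt_min_iff]
    exact ⟨⟨by linarith, by linarith⟩, by linarith, by linarith⟩
  have key := cont_induction hFc hF0 (by
    intro r hr hgood
    have hr0 : 0 < r := hR.trans_le hr
    have facts : ∀ t, R ≤ t → t ≤ r →
        (t * u1 t + (l + 1 : ℝ) * u t < b * u t ∧ t * v1 t + (l + 1 : ℝ) * v t < a * v t) ∧
        t ^ l * (t * u1 t + (l + 1 : ℝ) * u t) ≤ C / (a0 * m) / t ^ 2 ∧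
        t ^ l * (t * v1 t + (l + 1 : ℝ) * v t) ≤ C / (a0 * m) / t ^ 2 := by
      intro t ht1 ht2
      have ht0 : 0 < t := hR.trans_le ht1
      have hg := hgood t ht1 ht2
      simp only [F, le_min_iff] at hg
      obtain ⟨⟨g1, g2⟩, g3, g4⟩ := hg
      have hE := boot_alg (M := M) hs hps hqs ht0 (PU.pos t) (hu1 t) (PV.pos t) (hv1 t)
        (by linarith) (by linarith)
      have hpoh := prof_pohozaev PU PV hp hq ha hb hab t ht0
      set E := v t ^ (p + 1) / (p + 1) + u t ^ (q + 1) / (q + 1)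
      have hk1 := prof_k_nonneg PU t ht0.le
      have hk2 := prof_k_nonneg PV t ht0.le
      have e1 : t * u1 t + a * u t = (t * u1 t + (l + 1 : ℝ) * u t) - b * u t := by
        rw [← hab]; ring
      have e2 : t * v1 t + b * v t = (t * v1 t + (l + 1 : ℝ) * v t) - a * v t := by
        rw [← hab]; ring
      rw [e1, e2] at hpoh
      set x := t * u1 t + (l + 1 : ℝ) * u t
      set y := t * v1 t + (l + 1 : ℝ) * v t
      have hmu' := hmu.trans (prof_f_mono PU hR.le ht1)
      have hmv' := hmv.trans (prof_f_mono PV hR.le ht1)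
      have pu := PU.pos t
      have pv := PV.pos t
      have hcontra : t ^ 2 * E < a * b * (u t * v t) := by
        have q1 : m ^ 2 ≤ (t ^ (l + 1) * u t) * (t ^ (l + 1) * v t) := by
          rw [sq]; exact mul_le_mul hmu' hmv' hm.le (hm.le.trans hmu')
        have q2 : a0 ^ 2 ≤ a * b := by rw [sq]; exact mul_le_mul haa hbb ha0.le (ha0.le.trans haa)
        have q3 : a0 ^ 2 * m ^ 2 * R ≤ a * b * ((t ^ (l + 1) * u t) * (t ^ (l + 1) * v t)) * t := by
          have : 0 ≤ a * b := le_trans (sq_nonneg _) q2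
          gcongr
        have q4 : t ^ (2 * l + 3) * (t ^ 2 * E) < t ^ (2 * l + 3) * (a * b * (u t * v t)) := by
          calc t ^ (2 * l + 3) * (t ^ 2 * E) = t ^ (2 * l + 5) * E := by ring
            _ ≤ C := hE
            _ < _ := hR2
            _ ≤ _ := q3
            _ = _ := by ring
        exact lt_of_mul_lt_mul_left q4 (by positivity)
      have hxy : 0 < (x - b * u t) * (y - a * v t) := by rw [hpoh]; linarith
      have hx : x < b * u t := by
        rcases (show x ≤ b * u t by linarith).eq_or_lt with h | h
        · rw [h] at hxy; simp at hxy
        · exact h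
      have hy : y < a * v t := by
        rcases (show y ≤ a * v t by linarith).eq_or_lt with h | h
        · rw [h] at hxy; simp at hxy
        · exact h
      have hx2 : a * v t * x ≤ t ^ 2 * E := by
        have := mul_nonneg (sub_nonneg.2 hx.le) hk2
        linarith
      have hy2 : b * u t * y ≤ t ^ 2 * E := by
        have := mul_nonneg (sub_nonneg.2 hy.le) hk1
        linarith
      refine ⟨⟨hx, hy⟩, ?_, ?_⟩
      · rw [div_div, le_div_iff₀ (by positivity)]
        calc t ^ l * x * (a0 * m * t ^ 2) ≤ t ^ l * x * (a * (t ^ (l + 1) * v t) * t ^ 2) := by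
              gcongr
          _ = t ^ (2 * l + 3) * (a * v t * x) := by ring
          _ ≤ t ^ (2 * l + 3) * (t ^ 2 * E) := by gcongr
          _ = t ^ (2 * l + 5) * E := by ring
          _ ≤ C := hE
      · rw [div_div, le_div_iff₀ (by positivity)]
        calc t ^ l * y * (a0 * m * t ^ 2) ≤ t ^ l * y * (b * (t ^ (l + 1) * u t) * t ^ 2) := by
              gcongr
          _ = t ^ (2 * l + 3) * (b * u t * y) := by ring
          _ ≤ t ^ (2 * l + 3) * (t ^ 2 * E) := by gcongr
          _ = t ^ (2 * l + 5) * E := by ring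
          _ ≤ C := hE
    have grow : ∀ w w1 h : ℝ → ℝ, Prof l w w1 h → R ^ (l + 1) * w R ≤ M →
        (∀ t, R ≤ t → t ≤ r →
          t ^ l * (t * w1 t + (l + 1 : ℝ) * w t) ≤ C / (a0 * m) / t ^ 2) →
        r ^ (l + 1) * w r < 2 * M := by
      intro w w1 h P hMw hk
      have hcw := P.c0
      have hanti := antitone_aux_Icc (a := R) (b := r)
        (f := fun t => t ^ (l + 1) * w t + C / (a0 * m) * t⁻¹)
        (f' := fun t => ((l + 1 : ℕ) * t ^ l) * w t + t ^ (l + 1) * w1 t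
          + C / (a0 * m) * (-(t ^ 2)⁻¹))
        (by
          apply ContinuousOn.add
          · apply Continuous.continuousOn; fun_prop
          · apply ContinuousOn.mul continuousOn_const
            apply ContinuousOn.inv₀ continuousOn_id
            intro t ht
            exact (hR.trans_le ht.1).ne')
        (fun t ht1 ht2 => by
          have := ((hasDerivAt_pow (l + 1) t).mul (P.d0 t)).add
            ((hasDerivAt_inv (hR.trans ht1).ne').const_mul (C / (a0 * m)))
          refine this.congr_deriv ?_
          simp)
        (fun t ht1 ht2 => by
          have := hk t ht1.le ht2.le
          have e : ((l + 1 : ℕ) * t ^ l) * w t + t ^ (l + 1) * w1 t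
            = t ^ l * (t * w1 t + (l + 1 : ℝ) * w t) := by push_cast; ring
          rw [e]
          rw [div_eq_mul_inv _ (t ^ 2)] at this
          linarith)
      have h1 := hanti ⟨le_rfl, hr⟩ ⟨hr, le_rfl⟩ hr
      simp only at h1
      have h2 : C / (a0 * m) * R⁻¹ < M := by
        rw [← div_eq_mul_inv, div_div, div_lt_iff₀ (by positivity)]
        linarith
      have h3 : 0 < C / (a0 * m) * r⁻¹ := by positivity
      linarith
    have hfin := facts r hr le_rfl
    have g1 := grow u u1 _ PU hMu (fun t h1 h2 => (facts t h1 h2).2.1)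
    have g2 := grow v v1 _ PV hMv (fun t h1 h2 => (facts t h1 h2).2.2)
    simp only [F, lt_min_iff]
    exact ⟨⟨by linarith [hfin.1.1], by linarith [hfin.1.2]⟩, by linarith, by linarith⟩)
  intro r hr
  have := key r hr
  simp only [F, lt_min_iff] at this
  exact ⟨by linarith [this.2.1], by linarith [this.2.2]⟩

section radial
variable {l : ℕ}

noncomputable def e0 (l : ℕ) : EuclideanSpace ℝ (Fin (l + 3)) := EuclideanSpace.single 0 1

lemma norm_e0 : ‖e0 l‖ = 1 := by simp [e0]

lemma norm_r_e0 (r : ℝ) (hr : 0 ≤ r) : ‖r • e0 l‖ = r := by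
  rw [norm_smul, norm_e0, Real.norm_of_nonneg hr, mul_one]

lemma line_d1 {n : ℕ} {U : EuclideanSpace ℝ (Fin n) → ℝ} (hU : ContDiff ℝ 2 U)
    (x e : EuclideanSpace ℝ (Fin n)) (t : ℝ) :
    HasDerivAt (fun t : ℝ => U (x + t • e)) (fderiv ℝ U (x + t • e) e) t := by
  have h1 : HasDerivAt (fun t : ℝ => x + t • e) e t := by
    simpa using ((hasDerivAt_id t).smul_const e).const_add x
  have h2 : HasFDerivAt U (fderiv ℝ U (x + t • e)) (x + t • e) :=
    (hU.differentiable (by norm_num) _).hasFDerivAt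
  exact h2.comp_hasDerivAt t h1

lemma line_d2 {n : ℕ} {U : EuclideanSpace ℝ (Fin n) → ℝ} (hU : ContDiff ℝ 2 U)
    (x e : EuclideanSpace ℝ (Fin n)) (t : ℝ) :
    HasDerivAt (fun t : ℝ => fderiv ℝ U (x + t • e) e)
      (fderiv ℝ (fderiv ℝ U) (x + t • e) e e) t := by
  have h1 : HasDerivAt (fun t : ℝ => x + t • e) e t := by
    simpa using ((hasDerivAt_id t).smul_const e).const_add x
  have h0 : ContDiff ℝ 1 (fderiv ℝ U) := hU.fderiv_right (by norm_num)
  have h2 : HasFDerivAt (fderiv ℝ U) (fderiv ℝ (fderiv ℝ U) (x + t • e)) (x + t • e) :=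
    (h0.differentiable (by norm_num) _).hasFDerivAt
  have h3 := h2.comp_hasDerivAt t h1
  have h4 := h3.clm_apply (hasDerivAt_const t e)
  simpa using h4

lemma lap_nonpos_of_max {n : ℕ} {w : EuclideanSpace ℝ (Fin n) → ℝ} (hw : ContDiff ℝ 2 w)
    (x : EuclideanSpace ℝ (Fin n)) (hx : ∀ y, w y ≤ w x) : lap w x ≤ 0 := by
  unfold lap
  apply Finset.sum_nonpos
  intro i _
  set e : EuclideanSpace ℝ (Fin n) := EuclideanSpace.single i 1
  by_contra! hpos
  let g : ℝ → ℝ := fun t => w (x + t • e)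
  have hd : deriv g = fun t : ℝ => fderiv ℝ w (x + t • e) e := by
    funext t; exact (line_d1 hw x e t).deriv
  have hdd : deriv (deriv g) 0 = fderiv ℝ (fderiv ℝ w) x e e := by
    rw [hd, (line_d2 hw x e 0).deriv]; simp
  have hmax : IsLocalMax g 0 := Filter.Eventually.of_forall (fun t => by simpa [g] using hx _)
  have hd0 : deriv g 0 = 0 := hmax.deriv_eq_zero
  have hmin : IsLocalMin g 0 := isLocalMin_of_deriv_deriv_pos (by rw [hdd]; exact hpos) hd0
    (line_d1 hw x e 0).continuousAt
  have hconst : g =ᶠ[𝓝 0] fun _ => g 0 := by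
    filter_upwards [hmax, hmin] with t h1 h2 using le_antisymm h1 h2
  have h3 := hconst.deriv.deriv_eq
  rw [hdd] at h3
  simp at h3
  linarith

lemma lap_sub {n : ℕ} {U V : EuclideanSpace ℝ (Fin n) → ℝ} (hU : ContDiff ℝ 2 U)
    (hV : ContDiff ℝ 2 V) (x : EuclideanSpace ℝ (Fin n)) :
    lap (fun y => U y - V y) x = lap U x - lap V x := by
  unfold lap
  rw [← Finset.sum_sub_distrib]
  have h1 : fderiv ℝ (fun y => U y - V y) = fun y => fderiv ℝ U y - fderiv ℝ V y := by
    funext y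
    exact fderiv_fun_sub (hU.differentiable (by norm_num) _) (hV.differentiable (by norm_num) _)
  rw [h1, fderiv_fun_sub]
  · simp
  · exact (hU.fderiv_right (m := 1) (by norm_num)).differentiable (by norm_num) _
  · exact (hV.fderiv_right (m := 1) (by norm_num)).differentiable (by norm_num) _

lemma norm_perp (i : Fin (l + 3)) (hi : i ≠ 0) (r t : ℝ) :
    ‖r • e0 l + t • EuclideanSpace.single i (1:ℝ)‖ = √(r ^ 2 + t ^ 2) := by
  have hin : inner ℝ (r • e0 l) (t • EuclideanSpace.single i (1:ℝ)) = 0 := by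
    rw [real_inner_smul_left, real_inner_smul_right]
    simp [e0, EuclideanSpace.inner_single_left, hi.symm]
  have h := norm_add_sq_eq_norm_sq_add_norm_sq_real hin
  rw [eq_comm, Real.sqrt_eq_iff_mul_self_eq (by positivity) (norm_nonneg _), h]
  simp [norm_smul, norm_e0]
  ring

lemma radial_eq {U : EuclideanSpace ℝ (Fin (l + 3)) → ℝ}
    (hrad : ∀ x y, ‖x‖ = ‖y‖ → U x = U y) (x) : U x = U (‖x‖ • e0 l) :=
  hrad _ _ (norm_r_e0 _ (norm_nonneg _)).symm

lemma lap_radial {U : EuclideanSpace ℝ (Fin (l + 3)) → ℝ} (hU : ContDiff ℝ 2 U)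
    (hrad : ∀ x y, ‖x‖ = ‖y‖ → U x = U y) (r : ℝ) (hr : 0 < r) :
    lap U (r • e0 l) = fderiv ℝ (fderiv ℝ U) (r • e0 l) (e0 l) (e0 l) +
      (l + 2 : ℝ) / r * fderiv ℝ U (r • e0 l) (e0 l) := by
  have hperp : ∀ i : Fin (l + 3), i ≠ 0 →
      fderiv ℝ (fderiv ℝ U) (r • e0 l) (EuclideanSpace.single i 1) (EuclideanSpace.single i 1)
        = fderiv ℝ U (r • e0 l) (e0 l) / r := by
    intro i hi
    set e : EuclideanSpace ℝ (Fin (l + 3)) := EuclideanSpace.single i 1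
    have hpos : ∀ t : ℝ, 0 < r ^ 2 + t ^ 2 := fun t => by positivity
    have hline : ∀ s, HasDerivAt (fun t : ℝ => U (t • e0 l)) (fderiv ℝ U (s • e0 l) (e0 l)) s := by
      intro s; simpa using line_d1 hU 0 (e0 l) s
    have h1 : ∀ t : ℝ, fderiv ℝ U (r • e0 l + t • e) e =
        t * (fderiv ℝ U (√(r ^ 2 + t ^ 2) • e0 l) (e0 l) / √(r ^ 2 + t ^ 2)) := by
      intro t
      have h2 := line_d1 hU (r • e0 l) e t
      have h3 : (fun t : ℝ => U (r • e0 l + t • e)) = fun t => U (√(r ^ 2 + t ^ 2) • e0 l) := by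
        funext t
        rw [radial_eq hrad, norm_perp i hi]
      rw [h3] at h2
      have h4 : HasDerivAt (fun t : ℝ => √(r ^ 2 + t ^ 2)) (t / √(r ^ 2 + t ^ 2)) t := by
        have : HasDerivAt (fun t : ℝ => r ^ 2 + t ^ 2) (2 * t) t := by
          simpa using (hasDerivAt_pow 2 t).const_add (r ^ 2)
        refine (this.sqrt (hpos t).ne').congr_deriv ?_
        have := Real.sqrt_pos.2 (hpos t)
        field_simp
      have h5 := (hline _).comp t h4
      have := h2.unique h5
      rw [this]; ring
    have h2 := line_d2 hU (r • e0 l) e 0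
    simp only [h1] at h2
    have hcont : ContinuousAt (fun t : ℝ =>
        fderiv ℝ U (√(r ^ 2 + t ^ 2) • e0 l) (e0 l) / √(r ^ 2 + t ^ 2)) 0 := by
      have hc : Continuous (fderiv ℝ U) := hU.continuous_fderiv (by norm_num)
      apply ContinuousAt.div
      · apply Continuous.continuousAt
        fun_prop
      · fun_prop
      · exact (Real.sqrt_pos.2 (hpos 0)).ne'
    have h3 : HasDerivAt (fun t : ℝ => t * (fderiv ℝ U (√(r ^ 2 + t ^ 2) • e0 l) (e0 l) /
        √(r ^ 2 + t ^ 2))) (fderiv ℝ U (√(r ^ 2 + 0 ^ 2) • e0 l) (e0 l) / √(r ^ 2 + 0 ^ 2)) 0 := by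
      rw [hasDerivAt_iff_tendsto_slope_zero]
      have := hcont.tendsto.mono_left (nhdsWithin_le_nhds (s := {0}ᶜ))
      refine this.congr' ?_
      filter_upwards [self_mem_nhdsWithin] with t ht
      have ht' : t ≠ 0 := ht
      simp only [zero_add, zero_mul, sub_zero, smul_eq_mul]
      field_simp
    have h4 := h2.unique h3
    simpa [Real.sqrt_sq hr.le] using h4
  unfold lap
  rw [Fin.sum_univ_succ]
  rw [Finset.sum_congr rfl (fun i _ => hperp i.succ (Fin.succ_ne_zero i))]
  simp only [Finset.sum_const, Finset.card_univ, Fintype.card_fin, nsmul_eq_mul]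
  push_cast
  unfold e0
  ring

lemma prof_of_radial {U V : EuclideanSpace ℝ (Fin (l + 3)) → ℝ} {p : ℝ} (hU : ContDiff ℝ 2 U)
    (hpos : ∀ x, 0 < U x) (hVpos : ∀ x, 0 < V x) (hmono : ∀ x y, ‖x‖ ≤ ‖y‖ → U y ≤ U x)
    (heq : ∀ x, - lap U x = V x ^ p) :
    Prof l (fun r => U (r • e0 l)) (fun r => fderiv ℝ U (r • e0 l) (e0 l))
      (fun r => V (r • e0 l) ^ p) := by
  have hrad : ∀ x y, ‖x‖ = ‖y‖ → U x = U y :=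
    fun x y h => le_antisymm (hmono _ _ h.ge) (hmono _ _ h.le)
  have hline : ∀ s, HasDerivAt (fun t : ℝ => U (t • e0 l)) (fderiv ℝ U (s • e0 l) (e0 l)) s := by
    intro s; simpa using line_d1 hU 0 (e0 l) s
  constructor
  · exact hline
  · intro r hr
    have h2 : HasDerivAt (fun t : ℝ => fderiv ℝ U (t • e0 l) (e0 l))
      (fderiv ℝ (fderiv ℝ U) (r • e0 l) (e0 l) (e0 l)) r := by
      simpa using line_d2 hU 0 (e0 l) r
    refine h2.congr_deriv ?_
    have := lap_radial hU hrad r hr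
    have h3 := heq (r • e0 l)
    linarith
  · have hc : Continuous (fderiv ℝ U) := hU.continuous_fderiv (by norm_num)
    fun_prop
  · intro r; exact hpos _
  · intro r; exact (Real.rpow_pos_of_pos (hVpos _) _).le
  · intro r hr
    have hanti : AntitoneOn (fun t : ℝ => U (t • e0 l)) (Set.Ici 0) := by
      intro s hs t ht hst
      apply hmono
      rw [norm_r_e0 _ hs, norm_r_e0 _ ht]; exact hst
    have h1 := hanti.derivWithin_nonpos (x := r)
    rw [(hline r).hasDerivWithinAt.derivWithin (uniqueDiffOn_Ici 0 r hr)] at h1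
    exact h1

lemma fderiv_radial {U : EuclideanSpace ℝ (Fin (l + 3)) → ℝ} {u u1 : ℝ → ℝ}
    (hU : ∀ x, U x = u ‖x‖) (hd : ∀ r, HasDerivAt u (u1 r) r) (x) (hx : x ≠ 0) :
    fderiv ℝ U x = u1 ‖x‖ • fderiv ℝ (fun y : EuclideanSpace ℝ (Fin (l + 3)) => ‖y‖) x := by
  have h1 : HasFDerivAt (fun y : EuclideanSpace ℝ (Fin (l + 3)) => ‖y‖)
      (fderiv ℝ (fun y : EuclideanSpace ℝ (Fin (l + 3)) => ‖y‖) x) x :=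
    ((contDiffAt_norm (n := 1) ℝ hx).differentiableAt (by norm_num)).hasFDerivAt
  have h2 := (hd ‖x‖).comp_hasFDerivAt x h1
  have : U = u ∘ fun y => ‖y‖ := funext hU
  rw [this]
  exact h2.fderiv

lemma fderiv_radial_norm {U W : EuclideanSpace ℝ (Fin (l + 3)) → ℝ} {u u1 w w1 : ℝ → ℝ}
    (hU : ∀ x, U x = u ‖x‖) (hd : ∀ r, HasDerivAt u (u1 r) r)
    (hW : ∀ x, W x = w ‖x‖) (hdw : ∀ r, HasDerivAt w (w1 r) r) (x) (hx : x ≠ 0) :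
    ‖fderiv ℝ U x - fderiv ℝ W x‖ ≤ |u1 ‖x‖ - w1 ‖x‖| := by
  rw [fderiv_radial hU hd x hx, fderiv_radial hW hdw x hx, ← sub_smul, norm_smul]
  have := norm_fderiv_le_of_lipschitz ℝ (x₀ := x)
    (lipschitzWith_one_norm (E := EuclideanSpace ℝ (Fin (l + 3))))
  simp only [NNReal.coe_one] at this
  rw [Real.norm_eq_abs]
  have h2 := abs_nonneg (u1 ‖x‖ - w1 ‖x‖)
  nlinarith

lemma compare {n : ℕ} {p q : ℝ} (hp : 1 ≤ p) (hpq : p ≤ q)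
    {U V : EuclideanSpace ℝ (Fin n) → ℝ} (h : IsGroundState n p q U V) (x) :
    V x ≤ U x ∧ U x - V x ≤ q / p - 1 := by
  obtain ⟨hU, hV, pU, pV, eU, eV, mU, mV, tU, tV, u0⟩ := h
  have hU1 : ∀ x, U x ≤ 1 := fun x => by rw [← u0]; exact mU _ _ (by simp)
  have exmax : ∀ W : EuclideanSpace ℝ (Fin n) → ℝ, ContDiff ℝ 2 W →
      Tendsto W (cocompact _) (nhds 0) → ∀ x, 0 < W x → ∃ y, ∀ z, W z ≤ W y := by
    intro W hW tW x hx
    apply hW.continuous.exists_forall_ge' x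
    filter_upwards [tW.eventually_lt_const hx] with y hy using hy.le
  have hp0 : 0 < p := by linarith
  constructor
  · by_contra! hlt
    obtain ⟨y, hy⟩ := exmax (fun z => V z - U z) (hV.sub hU) (by simpa using tV.sub tU) x
      (by linarith)
    have h1 := lap_nonpos_of_max (hV.sub hU) y hy
    rw [lap_sub hV hU] at h1
    have h2 := eU y
    have h3 := eV y
    have h4 : U y < V y := by have := hy x; linarith
    have h5 : U y ^ p < V y ^ p := Real.rpow_lt_rpow (pU y).le h4 hp0
    have h6 : U y ^ q ≤ U y ^ p := Real.rpow_le_rpow_of_exponent_ge (pU y) (hU1 y) hpq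
    linarith
  · have hθ : 1 ≤ q / p := by rw [le_div_iff₀ hp0]; linarith
    by_contra! hlt
    obtain ⟨y, hy⟩ := exmax (fun z => U z - V z) (hU.sub hV) (by simpa using tU.sub tV) x
      (by linarith)
    have h1 := lap_nonpos_of_max (hU.sub hV) y hy
    rw [lap_sub hU hV] at h1
    have h2 := eU y
    have h3 := eV y
    have h4 : U y ^ q ≤ V y ^ p := by linarith
    have h5 : U y ^ (q / p) ≤ V y := by
      have := Real.rpow_le_rpow (Real.rpow_pos_of_pos (pU y) _).le h4 (inv_pos.2 hp0).le
      rwa [← Real.rpow_mul (pU y).le, ← Real.rpow_mul (pV y).le, mul_inv_cancel₀ hp0.ne',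
        Real.rpow_one, ← div_eq_mul_inv] at this
    have h6 := (rpow_exp_diff le_rfl hθ (pU y) (hU1 y)).2
    rw [Real.rpow_one] at h6
    have := hy x
    linarith

end radial

section bubble

noncomputable def NN (l : ℕ) : ℝ := (l + 3) * (l + 1)

noncomputable def ph (l : ℕ) (r : ℝ) : ℝ := (1 + r ^ 2 / NN l) ^ (-((l + 1 : ℝ) / 2))

noncomputable def ph1 (l : ℕ) (r : ℝ) : ℝ :=
  -(r / (l + 3)) * (1 + r ^ 2 / NN l) ^ (-((l + 3 : ℝ) / 2))

lemma NN_pos (l : ℕ) : 0 < NN l := by unfold NN; positivity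

lemma DD_pos (l : ℕ) (r : ℝ) : 0 < 1 + r ^ 2 / NN l := by have := NN_pos l; positivity

lemma ph_formula (l : ℕ) (c b : ℝ) (hc : c = NN l ^ ((l + 1 : ℝ) / 4))
    (hb : b = c ^ (2 / (l + 1 : ℝ))) (r : ℝ) :
    c * (b / (b ^ 2 + r ^ 2)) ^ ((l + 1 : ℝ) / 2) = ph l r := by
  have hN := NN_pos l
  have hb1 : b = NN l ^ ((1:ℝ) / 2) := by
    rw [hb, hc, ← Real.rpow_mul hN.le]
    congr 1
    field_simp
    norm_num
  have hb0 : 0 < b := by rw [hb1]; positivity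
  have hb2 : b ^ 2 = NN l := by
    rw [hb1, ← Real.sqrt_eq_rpow, Real.sq_sqrt hN.le]
  have hcb : c = b ^ ((l + 1 : ℝ) / 2) := by
    rw [hc, hb1, ← Real.rpow_mul hN.le]
    congr 1; ring
  rw [hcb, ← Real.mul_rpow hb0.le (by positivity)]
  unfold ph
  rw [Real.rpow_neg (DD_pos l r).le, ← Real.inv_rpow (DD_pos l r).le]
  congr 1
  rw [← mul_div_assoc, ← sq, hb2]
  field_simp

lemma DD_deriv (l : ℕ) (r : ℝ) : HasDerivAt (fun r => 1 + r ^ 2 / NN l) (2 * r / NN l) r := by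
  simpa using ((hasDerivAt_pow 2 r).div_const (NN l)).const_add 1

lemma DD_split (l : ℕ) (r : ℝ) : (1 + r ^ 2 / NN l) ^ (-((l + 1 : ℝ) / 2)) =
    (1 + r ^ 2 / NN l) ^ (-((l + 3 : ℝ) / 2)) * (1 + r ^ 2 / NN l) := by
  rw [← Real.rpow_add_one (DD_pos l r).ne']
  congr 1; ring

lemma ph_prof (l : ℕ) : Prof l (ph l) (ph1 l) (fun r => ph l r ^ ((l + 5 : ℝ) / (l + 1))) := by
  have hN := NN_pos l
  constructor
  · intro r
    refine ((DD_deriv l r).rpow_const (Or.inl (DD_pos l r).ne')).congr_deriv ?_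
    unfold ph1
    have : -((l + 1 : ℝ) / 2) - 1 = -((l + 3 : ℝ) / 2) := by ring
    rw [this]
    generalize (1 + r ^ 2 / NN l) ^ (-((l + 3 : ℝ) / 2)) = A
    unfold NN
    field_simp
  · intro r hr
    have h1 := ((DD_deriv l r).rpow_const (p := -((l + 3 : ℝ) / 2)) (Or.inl (DD_pos l r).ne'))
    have h2 := (((hasDerivAt_id r).div_const (l + 3 : ℝ)).neg).mul h1
    refine h2.congr_deriv ?_
    have e1 : ph l r ^ ((l + 5 : ℝ) / (l + 1)) =
        (1 + r ^ 2 / NN l) ^ (-((l + 3 : ℝ) / 2) - 1) := by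
      unfold ph
      rw [← Real.rpow_mul (DD_pos l r).le]
      congr 1
      field_simp
      ring
    have e2 : (1 + r ^ 2 / NN l) ^ (-((l + 3 : ℝ) / 2)) =
        (1 + r ^ 2 / NN l) ^ (-((l + 3 : ℝ) / 2) - 1) * (1 + r ^ 2 / NN l) := by
      rw [← Real.rpow_add_one (DD_pos l r).ne']
      congr 1; ring
    rw [e1]
    unfold ph1
    rw [e2]
    generalize (1 + r ^ 2 / NN l) ^ (-((l + 3 : ℝ) / 2) - 1) = A
    simp only [Pi.neg_apply, id]
    unfold NN
    field_simp
    ring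
  · unfold ph1
    apply Continuous.mul (by fun_prop)
    apply Continuous.rpow_const (by fun_prop)
    intro x; exact Or.inl (DD_pos l x).ne'
  · intro r; exact Real.rpow_pos_of_pos (DD_pos l r) _
  · intro r; exact Real.rpow_nonneg (Real.rpow_nonneg (DD_pos l r).le _) _
  · intro r hr
    unfold ph1
    have := Real.rpow_pos_of_pos (DD_pos l r) (-((l + 3 : ℝ) / 2))
    have h2 : 0 ≤ r / (l + 3) := by positivity
    nlinarith

lemma ph_zero (l : ℕ) : ph l 0 = 1 := by simp [ph]
lemma ph1_zero (l : ℕ) : ph1 l 0 = 0 := by simp [ph1]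

lemma ph_le_one (l : ℕ) (r : ℝ) : ph l r ≤ 1 := by
  unfold ph
  apply Real.rpow_le_one_of_one_le_of_nonpos
  · have := NN_pos l
    have : 0 ≤ r ^ 2 / NN l := by positivity
    linarith
  · have : (0:ℝ) ≤ (l + 1) / 2 := by positivity
    linarith

lemma ph_k (l : ℕ) (r : ℝ) : r * ph1 l r + (l + 1 : ℝ) * ph l r =
    (l + 1 : ℝ) * ph l r / (1 + r ^ 2 / NN l) := by
  have hD := DD_pos l r
  rw [eq_div_iff hD.ne']
  unfold ph1 ph
  rw [DD_split]
  generalize (1 + r ^ 2 / NN l) ^ (-((l + 3 : ℝ) / 2)) = A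
  unfold NN
  field_simp
  ring

lemma ph_f (l : ℕ) (r : ℝ) (hr : 0 ≤ r) : r ^ (l + 1) * ph l r =
    (r ^ 2 / (1 + r ^ 2 / NN l)) ^ ((l + 1 : ℝ) / 2) := by
  have hD := DD_pos l r
  unfold ph
  rw [Real.rpow_neg hD.le, Real.div_rpow (by positivity) hD.le, div_eq_mul_inv]
  congr 1
  rw [← Real.rpow_natCast r 2, ← Real.rpow_mul hr, ← Real.rpow_natCast]
  congr 1
  push_cast; ring

lemma ph_f_le (l : ℕ) (r : ℝ) (hr : 0 ≤ r) : r ^ (l + 1) * ph l r ≤ NN l ^ ((l + 1 : ℝ) / 2) := by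
  have hD := DD_pos l r
  have hN := NN_pos l
  rw [ph_f l r hr]
  apply Real.rpow_le_rpow (by positivity) _ (by positivity)
  rw [div_le_iff₀ hD, mul_add, mul_div_cancel₀ _ hN.ne']
  linarith

lemma ph_f_ge (l : ℕ) (r : ℝ) (hr : 0 ≤ r) (hrN : NN l ≤ r ^ 2) :
    (NN l / 2) ^ ((l + 1 : ℝ) / 2) ≤ r ^ (l + 1) * ph l r := by
  have hD := DD_pos l r
  have hN := NN_pos l
  rw [ph_f l r hr]
  apply Real.rpow_le_rpow (by positivity) _ (by positivity)
  rw [le_div_iff₀ hD]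
  have : NN l / 2 * (1 + r ^ 2 / NN l) = NN l / 2 + r ^ 2 / 2 := by field_simp
  rw [this]; linarith

end bubble

lemma prof_tail {l : ℕ} {u u1 h : ℝ → ℝ} (P : Prof l u u1 h) {r B : ℝ} (hr : 0 < r)
    (hB : r ^ (l + 1) * u r ≤ B) : |u1 r| ≤ (l + 1) * B / r ^ (l + 2) := by
  rw [abs_of_nonpos (P.neg r hr.le), le_div_iff₀ (by positivity)]
  have h1 := mul_nonneg (pow_nonneg hr.le (l + 1)) (prof_k_nonneg P r hr.le)
  have h2 : (l + 1 : ℝ) * (r ^ (l + 1) * u r) ≤ (l + 1) * B :=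
    mul_le_mul_of_nonneg_left hB (by positivity)
  have : r ^ (l + 1) * (r * u1 r + (l + 1 : ℝ) * u r) =
    u1 r * r ^ (l + 2) + (l + 1 : ℝ) * (r ^ (l + 1) * u r) := by ring
  linarith

lemma final_conv {l : ℕ} {W : ℕ → EuclideanSpace ℝ (Fin (l + 3)) → ℝ}
    {U2 : EuclideanSpace ℝ (Fin (l + 3)) → ℝ} {w w1 : ℕ → ℝ → ℝ} {f f1 : ℝ → ℝ} {C : ℝ}
    (hW : ∀ k x, W k x = w k ‖x‖) (hd : ∀ k r, HasDerivAt (w k) (w1 k r) r)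
    (hU2 : ∀ x, U2 x = f ‖x‖) (hf : ∀ r, HasDerivAt f (f1 r) r)
    (hconv : ∀ r, 0 ≤ r → Tendsto (fun k => w1 k r) atTop (𝓝 (f1 r)))
    (hdom : ∀ᶠ k in atTop, ∀ r, 0 ≤ r → |w1 k r - f1 r| ≤ C / (1 + r) ^ (l + 2)) :
    Tendsto (fun k => eLpNorm (fun x => fderiv ℝ (W k) x - fderiv ℝ U2 x) 2 volume)
      atTop (𝓝 0) := by
  have hne : ∀ᵐ x : EuclideanSpace ℝ (Fin (l + 3)) ∂volume, x ≠ 0 := Measure.ae_ne volume 0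
  have key : Tendsto (fun k => ∫⁻ x, ‖fderiv ℝ (W k) x - fderiv ℝ U2 x‖ₑ ^ (2:ℝ)) atTop
      (𝓝 (∫⁻ _ : EuclideanSpace ℝ (Fin (l + 3)), 0)) := by
    apply tendsto_lintegral_filter_of_dominated_convergence
      (fun x => ENNReal.ofReal (C ^ 2 * (1 + ‖x‖) ^ (-(2 * l + 4 : ℝ))))
    · refine Eventually.of_forall fun k => ?_
      exact (((measurable_fderiv ℝ (W k)).sub (measurable_fderiv ℝ U2)).enorm).pow_const _
    · filter_upwards [hdom] with k hk
      filter_upwards [hne] with x hx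
      have h1 := (fderiv_radial_norm (hW k) (hd k) hU2 hf x hx).trans (hk ‖x‖ (norm_nonneg x))
      rw [← ofReal_norm, ENNReal.ofReal_rpow_of_nonneg (norm_nonneg _) (by norm_num)]
      apply ENNReal.ofReal_le_ofReal
      have h2 : (0:ℝ) < 1 + ‖x‖ := by positivity
      calc ‖fderiv ℝ (W k) x - fderiv ℝ U2 x‖ ^ (2:ℝ)
          ≤ (C / (1 + ‖x‖) ^ (l + 2)) ^ (2:ℝ) := Real.rpow_le_rpow (norm_nonneg _) h1 (by norm_num)
        _ = C ^ 2 * (1 + ‖x‖) ^ (-(2 * l + 4 : ℝ)) := by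
          rw [Real.rpow_two, div_pow, ← pow_mul, Real.rpow_neg h2.le, ← div_eq_mul_inv,
            ← Real.rpow_natCast (1 + ‖x‖)]
          congr 2
          push_cast; ring
    · have hi : Integrable (fun x : EuclideanSpace ℝ (Fin (l + 3)) =>
          C ^ 2 * (1 + ‖x‖) ^ (-(2 * l + 4 : ℝ))) volume := by
        apply Integrable.const_mul
        apply integrable_one_add_norm
        simp
        have : (0:ℝ) ≤ l := Nat.cast_nonneg l
        linarith
      exact hi.lintegral_lt_top.ne
    · filter_upwards [hne] with x hx
      have h1 : Tendsto (fun k => ‖fderiv ℝ (W k) x - fderiv ℝ U2 x‖) atTop (𝓝 0) := by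
        have h2 : Tendsto (fun k => |w1 k ‖x‖ - f1 ‖x‖|) atTop (𝓝 0) := by
          have := ((hconv ‖x‖ (norm_nonneg x)).sub_const (f1 ‖x‖)).abs
          simpa using this
        exact squeeze_zero (fun _ => norm_nonneg _)
          (fun k => fderiv_radial_norm (hW k) (hd k) hU2 hf x hx) h2
      have h3 : Tendsto (fun k => ENNReal.ofReal ‖fderiv ℝ (W k) x - fderiv ℝ U2 x‖) atTop (𝓝 0) := by
        simpa using ENNReal.tendsto_ofReal h1
      have h4 := h3.ennrpow_const (2:ℝ)
      simpa [ofReal_norm] using h4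
  have h2 := key.ennrpow_const (1 / 2 : ℝ)
  simp only [lintegral_zero] at h2
  rw [ENNReal.zero_rpow_of_pos (by norm_num)] at h2
  refine h2.congr fun k => ?_
  rw [eLpNorm_eq_lintegral_rpow_enorm_toReal (by norm_num) (by norm_num)]
  simp

lemma prof_dom {l : ℕ} {w w1 h : ℝ → ℝ} (P : Prof l w w1 h) {R B : ℝ} (hR : 1 ≤ R) (hB : 0 ≤ B)
    (hin : ∀ r, 0 ≤ r → r ≤ R → |w1 r - ph1 l r| ≤ 1)
    (hout : ∀ r, R ≤ r → r ^ (l + 1) * w r ≤ B)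
    (hph : ∀ r, 0 ≤ r → r ^ (l + 1) * ph l r ≤ B) (r : ℝ) (hr : 0 ≤ r) :
    |w1 r - ph1 l r| ≤ ((1 + R) ^ (l + 2) + 2 * ((l + 1) * B) * 2 ^ (l + 2)) / (1 + r) ^ (l + 2) := by
  rw [le_div_iff₀ (by positivity)]
  have hpos : 0 ≤ 2 * ((l + 1 : ℝ) * B) * 2 ^ (l + 2) := by positivity
  rcases le_total r R with h1 | h1
  · have h2 : (1 + r) ^ (l + 2) ≤ (1 + R) ^ (l + 2) := by gcongr
    have h3 := mul_le_mul (hin r hr h1) h2 (by positivity) (by norm_num)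
    linarith
  · have hr0 : 0 < r := by linarith
    have h2 := prof_tail P hr0 (hout r h1)
    have h3 := prof_tail (ph_prof l) hr0 (hph r hr)
    have h4 : |w1 r - ph1 l r| ≤ 2 * ((l + 1) * B) / r ^ (l + 2) := by
      refine (abs_sub _ _).trans ?_
      have : 2 * ((l + 1) * B) / r ^ (l + 2) = (l + 1) * B / r ^ (l + 2) + (l + 1) * B / r ^ (l + 2) := by
        ring
      linarith
    have h5 : (1 + r) ^ (l + 2) ≤ 2 ^ (l + 2) * r ^ (l + 2) := by
      rw [← mul_pow]; gcongr; linarith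
    have h6 : |w1 r - ph1 l r| * (1 + r) ^ (l + 2) ≤
        2 * ((l + 1) * B) / r ^ (l + 2) * (2 ^ (l + 2) * r ^ (l + 2)) :=
      mul_le_mul h4 h5 (by positivity) (by positivity)
    have h7 : 2 * ((l + 1) * B) / r ^ (l + 2) * (2 ^ (l + 2) * r ^ (l + 2)) =
      2 * ((l + 1) * B) * 2 ^ (l + 2) := by field_simp
    have : 0 ≤ (1 + R) ^ (l + 2) := by positivity
    linarith

lemma seq_conv {l : ℕ} {w w1 h : ℕ → ℝ → ℝ} {ε : ℕ → ℝ}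
    (P : ∀ k, Prof l (w k) (w1 k) (h k)) (hle : ∀ k r, w k r ≤ 1)
    (hε : ∀ k r, |h k r - w k r ^ ((l + 5 : ℝ) / (l + 1))| ≤ ε k)
    (hε0 : Tendsto ε atTop (𝓝 0)) (h0 : Tendsto (fun k => w k 0) atTop (𝓝 1))
    (hz : ∀ k, w1 k 0 = 0) :
    (∀ r, 0 ≤ r → Tendsto (fun k => w k r) atTop (𝓝 (ph l r)) ∧
      Tendsto (fun k => w1 k r) atTop (𝓝 (ph1 l r))) ∧
    ∀ R, 0 ≤ R → ∀ᶠ k in atTop, ∀ r, 0 ≤ r → r ≤ R → |w1 k r - ph1 l r| ≤ 1 := by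
  set s : ℝ := (l + 5 : ℝ) / (l + 1) with hs
  have hs1 : 1 ≤ s := by
    rw [hs, le_div_iff₀ (by positivity)]; linarith
  let D : ℕ → ℝ := fun k => (w k 0 - 1) ^ 2 + ε k ^ 2
  have hD : Tendsto D atTop (𝓝 0) := by
    have := ((h0.sub_const 1).pow 2).add (hε0.pow 2)
    simpa using this
  have hD0 : ∀ k, 0 ≤ D k := fun k => by positivity
  have G : ∀ k r, 0 ≤ r → (w k r - ph l r) ^ 2 + (w1 k r - ph1 l r) ^ 2 ≤
      D k * Real.exp ((s + 2) * r) := by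
    intro k r hr
    have := prof_gronwall hs1 (P k) (ph_prof l) (hle k) (ph_le_one l) (hε k) r hr
    rw [hz, ph1_zero, ph_zero] at this
    simpa [D] using this
  constructor
  · intro r hr
    have hE : Tendsto (fun k => √(D k * Real.exp ((s + 2) * r))) atTop (𝓝 0) := by
      have := (hD.mul_const (Real.exp ((s + 2) * r))).sqrt
      simpa using this
    constructor
    · rw [tendsto_iff_norm_sub_tendsto_zero]
      refine squeeze_zero (fun _ => norm_nonneg _) (fun k => ?_) hE
      apply Real.le_sqrt_of_sq_le
      rw [Real.norm_eq_abs, sq_abs]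
      have := G k r hr
      nlinarith [sq_nonneg (w1 k r - ph1 l r)]
    · rw [tendsto_iff_norm_sub_tendsto_zero]
      refine squeeze_zero (fun _ => norm_nonneg _) (fun k => ?_) hE
      apply Real.le_sqrt_of_sq_le
      rw [Real.norm_eq_abs, sq_abs]
      have := G k r hr
      nlinarith [sq_nonneg (w k r - ph l r)]
  · intro R hR
    have hE : Tendsto (fun k => D k * Real.exp ((s + 2) * R)) atTop (𝓝 0) := by
      have := hD.mul_const (Real.exp ((s + 2) * R))
      simpa using this
    filter_upwards [hE.eventually_le_const (show (0:ℝ) < 1 by norm_num)] with k hk r hr hrR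
    have h1 := G k r hr
    have h2 : D k * Real.exp ((s + 2) * r) ≤ D k * Real.exp ((s + 2) * R) := by
      apply mul_le_mul_of_nonneg_left _ (hD0 k)
      apply Real.exp_le_exp.2
      gcongr
    rw [← sq_le_one_iff_abs_le_one]
    nlinarith [sq_nonneg (w k r - ph l r)]

lemma fderiv_zero_of_mono {l : ℕ} {U : EuclideanSpace ℝ (Fin (l + 3)) → ℝ}
    (hmono : ∀ x y, ‖x‖ ≤ ‖y‖ → U y ≤ U x) : fderiv ℝ U ((0:ℝ) • e0 l) (e0 l) = 0 := by
  have : IsLocalMax U 0 := Eventually.of_forall fun y => hmono 0 y (by simp)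
  rw [zero_smul, this.fderiv_eq_zero]; rfl

lemma main_aux (l : ℕ) (p q : ℕ → ℝ) (hq : ∀ k, 0 < q k)
    (hpq : ∀ k, 1 / (p k + 1) + 1 / (q k + 1) = (l + 1 : ℝ) / (l + 3))
    (hp1 : ∀ k, 1 ≤ p k) (hp2 : ∀ k, p k ≤ (l + 5 : ℝ) / (l + 1))
    (hlim : Tendsto p atTop (nhds ((l + 5 : ℝ) / (l + 1))))
    (U V : ℕ → EuclideanSpace ℝ (Fin (l + 3)) → ℝ)
    (hgs : ∀ k, IsGroundState (l + 3) (p k) (q k) (U k) (V k))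
    (U2 : EuclideanSpace ℝ (Fin (l + 3)) → ℝ) (hU2 : ∀ x, U2 x = ph l ‖x‖) :
    Tendsto (fun k => eLpNorm (fun x => fderiv ℝ (U k) x - fderiv ℝ U2 x) 2 volume)
      atTop (nhds 0) ∧
    Tendsto (fun k => eLpNorm (fun x => fderiv ℝ (V k) x - fderiv ℝ U2 x) 2 volume)
      atTop (nhds 0) := by
  set s : ℝ := (l + 5 : ℝ) / (l + 1) with hs
  have hs1 : 1 ≤ s := by
    rw [hs, le_div_iff₀ (by positivity)]; linarith
  have hs0 : s + 1 = 2 * ((l + 3 : ℝ) / (l + 1)) := by rw [hs]; field_simp; ring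
  have hl0 : (0:ℝ) < l + 1 := by positivity
  have hp0 : ∀ k, 0 < p k := fun k => by linarith [hp1 k]
  have hqs : ∀ k, s ≤ q k := by
    intro k
    have h1 : 1 / (s + 1) ≤ 1 / (p k + 1) :=
      one_div_le_one_div_of_le (by linarith [hp0 k]) (by linarith [hp2 k])
    have h2 : 1 / (s + 1) = (l + 1 : ℝ) / (l + 3) / 2 := by rw [hs0]; field_simp
    have h3 : 1 / (q k + 1) ≤ 1 / (s + 1) := by have := hpq k; linarith
    have := (one_div_le_one_div (by linarith [hq k]) (by linarith)).1 h3
    linarith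
  have hpleq : ∀ k, p k ≤ q k := fun k => (hp2 k).trans (hqs k)
  let a : ℕ → ℝ := fun k => (l + 3 : ℝ) / (q k + 1)
  let b : ℕ → ℝ := fun k => (l + 3 : ℝ) / (p k + 1)
  have ha : ∀ k, a k * (q k + 1) = l + 3 := fun k => by
    have := hq k; simp only [a]; field_simp
  have hb : ∀ k, b k * (p k + 1) = l + 3 := fun k => by
    have := hp0 k; simp only [b]; field_simp
  have hab : ∀ k, a k + b k = l + 1 := fun k => by
    have h1 : a k + b k = (l + 3 : ℝ) * (1 / (p k + 1) + 1 / (q k + 1)) := by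
      simp only [a, b]; ring
    rw [h1, hpq]; field_simp
  have hblim : Tendsto b atTop (𝓝 ((l + 1 : ℝ) / 2)) := by
    have : Tendsto b atTop (𝓝 ((l + 3 : ℝ) / (s + 1))) :=
      tendsto_const_nhds.div (hlim.add_const 1) (by linarith)
    rw [hs0] at this
    convert this using 2
    field_simp
  have halim : Tendsto a atTop (𝓝 ((l + 1 : ℝ) / 2)) := by
    have h1 : a = fun k => (l + 1 : ℝ) - b k := by funext k; linarith [hab k]
    rw [h1]
    convert hblim.const_sub (l + 1 : ℝ) using 2
    ring
  have hqlim : Tendsto q atTop (𝓝 s) := by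
    have h1 : q = fun k => (l + 3 : ℝ) / a k - 1 := by
      funext k
      have := hq k
      simp only [a]; field_simp; ring
    rw [h1]
    have h2 : Tendsto (fun k => (l + 3 : ℝ) / a k - 1) atTop (𝓝 ((l + 3 : ℝ) / ((l + 1 : ℝ) / 2) - 1)) :=
      (tendsto_const_nhds.div halim (by positivity)).sub_const 1
    have h3 : (l + 3 : ℝ) / ((l + 1 : ℝ) / 2) - 1 = s := by rw [hs]; field_simp; ring
    rwa [h3] at h2
  let u : ℕ → ℝ → ℝ := fun k r => U k (r • e0 l)
  let v : ℕ → ℝ → ℝ := fun k r => V k (r • e0 l)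
  let u1 : ℕ → ℝ → ℝ := fun k r => fderiv ℝ (U k) (r • e0 l) (e0 l)
  let v1 : ℕ → ℝ → ℝ := fun k r => fderiv ℝ (V k) (r • e0 l) (e0 l)
  have PU : ∀ k, Prof l (u k) (u1 k) (fun r => v k r ^ p k) := by
    intro k
    obtain ⟨hU, hV, pU, pV, eU, eV, mU, mV, tU, tV, u0⟩ := hgs k
    exact prof_of_radial hU pU pV mU eU
  have PV : ∀ k, Prof l (v k) (v1 k) (fun r => u k r ^ q k) := by
    intro k
    obtain ⟨hU, hV, pU, pV, eU, eV, mU, mV, tU, tV, u0⟩ := hgs k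
    exact prof_of_radial hV pV pU mV eV
  have hUr : ∀ k x, U k x = u k ‖x‖ := by
    intro k x
    obtain ⟨hU, hV, pU, pV, eU, eV, mU, mV, tU, tV, u0⟩ := hgs k
    exact radial_eq (fun x y h => le_antisymm (mU _ _ h.ge) (mU _ _ h.le)) x
  have hVr : ∀ k x, V k x = v k ‖x‖ := by
    intro k x
    obtain ⟨hU, hV, pU, pV, eU, eV, mU, mV, tU, tV, u0⟩ := hgs k
    exact radial_eq (fun x y h => le_antisymm (mV _ _ h.ge) (mV _ _ h.le)) x
  have hu0 : ∀ k, u k 0 = 1 := by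
    intro k
    obtain ⟨hU, hV, pU, pV, eU, eV, mU, mV, tU, tV, u0⟩ := hgs k
    simpa [u] using u0
  have huz : ∀ k, u1 k 0 = 0 := by
    intro k
    obtain ⟨hU, hV, pU, pV, eU, eV, mU, mV, tU, tV, u0⟩ := hgs k
    exact fderiv_zero_of_mono mU
  have hvz : ∀ k, v1 k 0 = 0 := by
    intro k
    obtain ⟨hU, hV, pU, pV, eU, eV, mU, mV, tU, tV, u0⟩ := hgs k
    exact fderiv_zero_of_mono mV
  have hule : ∀ k r, u k r ≤ 1 := by
    intro k r
    obtain ⟨hU, hV, pU, pV, eU, eV, mU, mV, tU, tV, u0⟩ := hgs k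
    rw [← u0]; exact mU _ _ (by simp)
  have hcmp : ∀ k r, v k r ≤ u k r ∧ u k r - v k r ≤ q k / p k - 1 := fun k r =>
    compare (hp1 k) (hpleq k) (hgs k) _
  have hvle : ∀ k r, v k r ≤ 1 := fun k r => (hcmp k r).1.trans (hule k r)
  have hδlim : Tendsto (fun k => q k / p k - 1) atTop (𝓝 0) := by
    have := (hqlim.div hlim (by linarith)).sub_const 1
    rwa [div_self (by linarith), sub_self] at this
  have habs : ∀ k r, |v k r ^ s - u k r ^ s| ≤ s * (q k / p k - 1) := by
    intro k r
    refine (rpow_lip hs1 ((PU k).pos r).le (hule k r) ((PV k).pos r).le (hvle k r)).trans ?_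
    apply mul_le_mul_of_nonneg_left _ (by linarith)
    rw [abs_sub_comm, abs_of_nonneg (by linarith [(hcmp k r).1])]
    exact (hcmp k r).2
  obtain ⟨cU, dU⟩ := seq_conv (ε := fun k => (s - p k) + s * (q k / p k - 1)) PU hule
    (by
      intro k r
      have h1 := rpow_exp_diff (hp1 k) (hp2 k) ((PV k).pos r) (hvle k r)
      have h2 := habs k r
      calc |v k r ^ p k - u k r ^ s| = |(v k r ^ p k - v k r ^ s) + (v k r ^ s - u k r ^ s)| := by
            ring_nf
        _ ≤ _ := abs_add_le _ _
        _ ≤ _ := add_le_add (by rw [abs_of_nonneg h1.1]; exact h1.2) h2)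
    (by simpa using (hlim.const_sub s).add (hδlim.const_mul s))
    (by simp [hu0]) huz
  obtain ⟨cV, dV⟩ := seq_conv (ε := fun k => (q k - s) + s * (q k / p k - 1)) PV hvle
    (by
      intro k r
      have h1 := rpow_exp_diff hs1 (hqs k) ((PU k).pos r) (hule k r)
      have h2 := habs k r
      calc |u k r ^ q k - v k r ^ s| = |(u k r ^ q k - u k r ^ s) + (u k r ^ s - v k r ^ s)| := by
            ring_nf
        _ ≤ _ := abs_add_le _ _
        _ ≤ _ := add_le_add (by rw [abs_sub_comm, abs_of_nonneg h1.1]; exact h1.2)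
          (by rw [abs_sub_comm]; exact h2))
    (by simpa using (hqlim.sub_const s).add (hδlim.const_mul s))
    (by
      have h1 : Tendsto (fun k => 1 - (q k / p k - 1)) atTop (𝓝 1) := by
        simpa using hδlim.const_sub 1
      refine tendsto_of_tendsto_of_tendsto_of_le_of_le h1 tendsto_const_nhds ?_ ?_
      · intro k
        have := (hcmp k 0).2
        rw [hu0] at this
        simp only; linarith
      · intro k; exact hvle k 0) hvz
  have hN := NN_pos l
  set L : ℝ := NN l ^ ((l + 1 : ℝ) / 2) with hL
  set m0 : ℝ := (NN l / 2) ^ ((l + 1 : ℝ) / 2) with hm0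
  have hLp : 0 < L := by positivity
  have hm0p : 0 < m0 := by positivity
  set m := m0 / 2
  set M := 2 * L with hM
  have hmp : 0 < m := by positivity
  have hMp : 0 < M := by positivity
  set s' : ℝ := (2 * l + 5 : ℝ) / (l + 1) with hs'
  set a0 : ℝ := (l + 1 : ℝ) / 4 with ha0
  have ha0p : 0 < a0 := by positivity
  obtain ⟨R, hR1, hR2, hR3, hR4⟩ : ∃ R : ℝ, 1 ≤ R ∧ 8 * NN l ≤ R ∧
      2 * (2 * M) ^ s' / (a0 * m * M) < R ∧ 2 * (2 * M) ^ s' / (a0 ^ 2 * m ^ 2) < R :=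
    ((eventually_ge_atTop _).and ((eventually_ge_atTop _).and
      ((eventually_gt_atTop _).and (eventually_gt_atTop _)))).exists
  rw [div_lt_iff₀ (by positivity)] at hR3 hR4
  have hR0 : 0 < R := by linarith
  have hRN : 8 * NN l ≤ R ^ 2 := by nlinarith
  have hphpos : 0 < ph l R := (ph_prof l).pos R
  have hphk : R * ph1 l R + (l + 1 : ℝ) * ph l R < (l + 1 : ℝ) / 2 * ph l R := by
    rw [ph_k, div_lt_iff₀ (DD_pos l R)]
    have h1 : 8 ≤ R ^ 2 / NN l := by rw [le_div_iff₀ hN]; exact hRN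
    have h2 : 0 < (l + 1 : ℝ) * ph l R := by positivity
    nlinarith
  have hfge := ph_f_ge l R hR0.le (by linarith)
  have hfle := ph_f_le l R hR0.le
  have hkc : ∀ (w w1 : ℕ → ℝ → ℝ) (a : ℕ → ℝ), Tendsto a atTop (𝓝 ((l + 1 : ℝ) / 2)) →
      (∀ r, 0 ≤ r → Tendsto (fun k => w k r) atTop (𝓝 (ph l r)) ∧
        Tendsto (fun k => w1 k r) atTop (𝓝 (ph1 l r))) →
      ∀ᶠ k in atTop, m ≤ R ^ (l + 1) * w k R ∧ R ^ (l + 1) * w k R ≤ M ∧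
        R * w1 k R + (l + 1 : ℝ) * w k R < a k * w k R ∧ a0 ≤ a k := by
    intro w w1 a ha hc
    obtain ⟨h1, h2⟩ := hc R hR0.le
    have h3 := h1.const_mul (R ^ (l + 1))
    have h4 := (h2.const_mul R).add (h1.const_mul (l + 1 : ℝ))
    have h5 := ha.mul h1
    have e1 := h3.eventually_const_le (show m < R ^ (l + 1) * ph l R by
      simp only [m]; linarith)
    have e2 := h3.eventually_le_const (show R ^ (l + 1) * ph l R < M by
      linarith)
    have e3 := h4.eventually_lt h5 hphk
    have e4 := ha.eventually_const_le (show a0 < (l + 1 : ℝ) / 2 by rw [ha0]; linarith)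
    filter_upwards [e1, e2, e3, e4] with k g1 g2 g3 g4 using ⟨g1, g2, g3, g4⟩
  have hs'p : ∀ᶠ k in atTop, s' ≤ p k + 1 := by
    apply (hlim.add_const 1).eventually_const_le
    rw [hs0, hs', ← mul_div_assoc]
    apply div_lt_div_of_pos_right _ hl0
    linarith
  have hboot : ∀ᶠ k in atTop, ∀ r, R ≤ r →
      r ^ (l + 1) * u k r ≤ 2 * M ∧ r ^ (l + 1) * v k r ≤ 2 * M := by
    filter_upwards [hkc u u1 b hblim cU, hkc v v1 a halim cV, hs'p] with k gu gv gs
    exact prof_boot (PU k) (PV k) (hule k) (hvle k) (hp0 k) (hq k) (ha k) (hb k) (hab k)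
      (s := s') (by rw [hs']; field_simp) gs (by linarith [hpleq k]) ha0p gv.2.2.2 gu.2.2.2 hmp hR0
      gu.1 gv.1 gu.2.1 gv.2.1 gu.2.2.1 gv.2.2.1 (by linarith) (by linarith)
  have hphB : ∀ r, 0 ≤ r → r ^ (l + 1) * ph l r ≤ 2 * M := fun r hr => by
    have := ph_f_le l r hr
    linarith
  constructor
  · refine final_conv hUr (fun k => (PU k).d0) hU2 (ph_prof l).d0 (fun r hr => (cU r hr).2)
      (C := (1 + R) ^ (l + 2) + 2 * ((l + 1) * (2 * M)) * 2 ^ (l + 2)) ?_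
    filter_upwards [hboot, dU R hR0.le] with k h1 h2
    exact prof_dom (PU k) hR1 (by positivity) h2 (fun r hr => (h1 r hr).1) hphB
  · refine final_conv hVr (fun k => (PV k).d0) hU2 (ph_prof l).d0 (fun r hr => (cV r hr).2)
      (C := (1 + R) ^ (l + 2) + 2 * ((l + 1) * (2 * M)) * 2 ^ (l + 2)) ?_
    filter_upwards [hboot, dV R hR0.le] with k h1 h2
    exact prof_dom (PV k) hR1 (by positivity) h2 (fun r hr => (h1 r hr).2) hphB


theorem ground_state_convergence_near_critical (n : ℕ) (hn : 3 ≤ n)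
    (p q : ℕ → ℝ) (hp : ∀ k, 0 < p k) (hq : ∀ k, 0 < q k)
    (hpq : ∀ k, 1 / (p k + 1) + 1 / (q k + 1) = ((n : ℝ) - 2) / n)
    (hrange : ∀ k, p k ∈ Set.Icc ((n : ℝ) / ((n : ℝ) - 2)) (((n : ℝ) + 2) / ((n : ℝ) - 2)))
    (hlim : Tendsto p atTop (nhds (((n : ℝ) + 2) / ((n : ℝ) - 2))))
    (U V : ℕ → EuclideanSpace ℝ (Fin n) → ℝ)
    (hgs : ∀ k, IsGroundState n (p k) (q k) (U k) (V k))
    (c b : ℝ)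
    (hc : c = ((n : ℝ) * ((n : ℝ) - 2)) ^ (((n : ℝ) - 2) / 4))
    (hb : b = c ^ (2 / ((n : ℝ) - 2)))
    (U2 : EuclideanSpace ℝ (Fin n) → ℝ)
    (hU2 : ∀ x, U2 x = c * (b / (b ^ 2 + ‖x‖ ^ 2)) ^ (((n : ℝ) - 2) / 2)) :
    Tendsto (fun k => eLpNorm (fun x => fderiv ℝ (U k) x - fderiv ℝ U2 x) 2 volume)
      atTop (nhds 0) ∧
    Tendsto (fun k => eLpNorm (fun x => fderiv ℝ (V k) x - fderiv ℝ U2 x) 2 volume)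
      atTop (nhds 0) := by
  obtain ⟨l, rfl⟩ : ∃ l, n = l + 3 := ⟨n - 3, by omega⟩
  have e1 : ((l + 3 : ℕ) : ℝ) - 2 = l + 1 := by push_cast; ring
  have e2 : ((l + 3 : ℕ) : ℝ) + 2 = l + 5 := by push_cast; ring
  have e3 : ((l + 3 : ℕ) : ℝ) = l + 3 := by push_cast; ring
  simp only [e1, e2] at hpq hrange hlim hc hb hU2
  simp only [e3] at hpq hrange hc
  refine main_aux l p q hq hpq (fun k => ?_) (fun k => (hrange k).2) hlim U V hgs U2 (fun x => ?_)
  · refine le_trans ?_ (hrange k).1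
    rw [le_div_iff₀ (by positivity)]; linarith
  · rw [hU2]
    exact ph_formula l c b hc hb ‖x‖
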